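/- Let u ∈ BV²(R^N) (i.e., u ∈ W^{1,1}(R^N) with ∇u ∈ BV(R^N, R^N)) and let ρ be nonnegative, radially symmetric with ∫ρ = 1. Then ∫_{R^N} ∫_{R^N} |u(x+h) - 2u(x) + u(x-h)| / |h|² ρ(h) dh dx ≤ M |D²u|(R^N), with a constant M depending only on N. -/

import Mathlib

open MeasureTheory
open scoped ContDiff

section Duality

variable {E : Type*} [NormedAddCommGroup E] [NormedSpace ℝ E] [MeasurableSpace E] [BorelSpace E]
  {μ : Measure E}

/-- The `L¹` norm is bounded by testing against smooth compactly supported functions with values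
in `[-1, 1]`. -/
theorem integral_abs_le_of_forall_contDiff [FiniteDimensional ℝ E] [IsFiniteMeasureOnCompacts μ]
    {w : E → ℝ} (hw : Integrable w μ) {C : ℝ}
    (h : ∀ ψ : E → ℝ, ContDiff ℝ ∞ ψ → HasCompactSupport ψ → (∀ x, |ψ x| ≤ 1) →
      ∫ x, w x * ψ x ∂μ ≤ C) :
    ∫ x, |w x| ∂μ ≤ C := by
  refine le_of_forall_pos_le_add fun ε hε => ?_
  obtain ⟨v, hvc, hvs, hv⟩ := MemLp.exist_eLpNorm_sub_le (μ := μ) (p := 1)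
    ENNReal.one_ne_top le_rfl (memLp_one_iff_integrable.2 hw) (ε := ε / 3) (by positivity)
  have hvi : Integrable v μ := hvs.continuous.integrable_of_hasCompactSupport hvc
  have hd : ∫ x, |w x - v x| ∂μ ≤ ε / 3 := by
    rw [eLpNorm_one_eq_lintegral_enorm, ← ofReal_integral_norm_eq_lintegral_enorm (hw.sub hvi),
      ENNReal.ofReal_le_ofReal_iff (by positivity)] at hv
    exact hv
  set K := tsupport v with hK
  have hKm : MeasurableSet K := (isClosed_tsupport v).measurableSet
  have hKf : μ K < ⊤ := hvc.isCompact.measure_lt_top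
  set δ := ε / (3 * (1 + μ.real K)) with hδ
  have hm : 0 ≤ μ.real K := measureReal_nonneg
  have hδ0 : 0 < δ := by positivity
  have hδK : δ * μ.real K ≤ ε / 3 := by
    rw [hδ, div_mul_eq_mul_div, div_le_div_iff₀ (by positivity) (by positivity)]
    nlinarith
  have hpos : ∀ x, 0 < v x ^ 2 + δ ^ 2 := fun x => by positivity
  set ψ : E → ℝ := fun x => v x / √(v x ^ 2 + δ ^ 2) with hψ
  have hψs : ContDiff ℝ ∞ ψ :=
    hvs.div (((hvs.pow 2).add contDiff_const).sqrt fun x => (hpos x).ne')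
      fun x => (Real.sqrt_pos.2 (hpos x)).ne'
  have hψc : HasCompactSupport ψ := hvc.mono fun x hx => by
    contrapose! hx
    simp [hψ, Function.notMem_support.1 hx]
  have hle : ∀ x, |v x| ≤ √(v x ^ 2 + δ ^ 2) := fun x =>
    Real.abs_le_sqrt (by nlinarith [sq_nonneg δ])
  have hψ1 : ∀ x, |ψ x| ≤ 1 := fun x => by
    rw [hψ, abs_div, abs_of_pos (Real.sqrt_pos.2 (hpos x))]
    exact div_le_one_of_le₀ (hle x) (Real.sqrt_nonneg _)
  have hvψ : ∀ x, |v x| ≤ v x * ψ x + K.indicator (fun _ => δ) x := fun x => by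
    by_cases hx : x ∈ K
    · rw [Set.indicator_of_mem hx]
      have hs := Real.sqrt_pos.2 (hpos x)
      have hs2 : √(v x ^ 2 + δ ^ 2) ≤ |v x| + δ := by
        rw [Real.sqrt_le_left (by positivity)]
        nlinarith [sq_abs (v x), mul_nonneg (abs_nonneg (v x)) hδ0.le]
      have : v x * ψ x = |v x| ^ 2 / √(v x ^ 2 + δ ^ 2) := by
        rw [hψ, sq_abs]; ring
      rw [this, ← sub_le_iff_le_add, le_div_iff₀ hs]
      nlinarith [hle x, abs_nonneg (v x)]
    · have : v x = 0 := image_eq_zero_of_notMem_tsupport hx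
      simp [this, hx]
  have hpt : ∀ x, |w x| ≤ w x * ψ x + 2 * |w x - v x| + K.indicator (fun _ => δ) x := fun x => by
    have h1 : |w x| ≤ |v x| + |w x - v x| := by
      have := abs_add_le (v x) (w x - v x)
      simpa using this
    have h2 : (v x - w x) * ψ x ≤ |w x - v x| := by
      refine (le_abs_self _).trans ?_
      rw [abs_mul, abs_sub_comm]
      exact mul_le_of_le_one_right (abs_nonneg _) (hψ1 x)
    linarith [hvψ x]
  have hwψ : Integrable (fun x => w x * ψ x) μ :=
    hw.mul_bdd (c := 1) hψs.continuous.aestronglyMeasurable (.of_forall hψ1)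
  have hwv : Integrable (fun x => 2 * |w x - v x|) μ := (hw.sub hvi).abs.const_mul 2
  have hind : Integrable (K.indicator fun _ => δ) μ :=
    (integrable_indicator_iff hKm).2 (integrableOn_const hKf.ne)
  calc ∫ x, |w x| ∂μ
      ≤ ∫ x, w x * ψ x + 2 * |w x - v x| + K.indicator (fun _ => δ) x ∂μ :=
        integral_mono hw.abs ((hwψ.add hwv).add hind) hpt
    _ = (∫ x, w x * ψ x ∂μ) + 2 * (∫ x, |w x - v x| ∂μ) + δ * μ.real K := by
        rw [integral_add (by exact hwψ.add hwv) hind, integral_add hwψ hwv, integral_const_mul,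
          integral_indicator hKm, setIntegral_const, smul_eq_mul, mul_comm δ]
    _ ≤ C + ε := by linarith [h ψ hψs hψc hψ1]

/-- Differentiation of the correlation of `u` with a `C¹` test function along a line. -/
theorem hasDerivAt_integral_mul_comp_add_smul {u ψ : E → ℝ} (hu : Integrable u μ)
    (hψ : ContDiff ℝ 1 ψ) (hc : HasCompactSupport ψ) (h : E) (t : ℝ) :
    HasDerivAt (fun s : ℝ => ∫ x, u x * ψ (x + s • h) ∂μ)
      (∫ x, u x * fderiv ℝ ψ (x + t • h) h ∂μ) t := by
  have hψ' : Continuous fun x => fderiv ℝ ψ x h := by fun_prop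
  obtain ⟨C, hC⟩ := (hc.fderiv_apply ℝ h).exists_bound_of_continuous hψ'
  obtain ⟨D, hD⟩ := hc.exists_bound_of_continuous hψ.continuous
  have hcont : ∀ s : ℝ, Continuous fun x : E => ψ (x + s • h) := fun s => by fun_prop
  refine (hasDerivAt_integral_of_dominated_loc_of_deriv_le (s := Set.univ)
    (bound := fun x => |u x| * C) (F := fun s x => u x * ψ (x + s • h))
    (F' := fun s x => u x * fderiv ℝ ψ (x + s • h) h) Filter.univ_mem
    (.of_forall fun s => hu.aestronglyMeasurable.mul (hcont s).aestronglyMeasurable)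
    (hu.mul_bdd (c := D) (hcont t).aestronglyMeasurable (.of_forall fun x => hD _))
    (hu.aestronglyMeasurable.mul (Continuous.aestronglyMeasurable
      (by exact hψ'.comp (continuous_id.add continuous_const))))
    (.of_forall fun x s _ => ?_) (hu.abs.mul_const C) (.of_forall fun x s _ => ?_)).2
  · rw [norm_mul]
    exact mul_le_mul_of_nonneg_left (hC _) (abs_nonneg _)
  · have h1 : HasDerivAt (fun s : ℝ => x + s • h) h s := by
      simpa using ((hasDerivAt_id s).smul_const h).const_add x
    exact (((hψ.differentiable one_ne_zero) _).hasFDerivAt.comp_hasDerivAt s h1).const_mul _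

end Duality

/-- A function with second derivative at most `c` has symmetric second difference at most `c`. -/
theorem second_difference_le_of_deriv2_le {F F' F'' : ℝ → ℝ} {c : ℝ}
    (h1 : ∀ t, HasDerivAt F (F' t) t) (h2 : ∀ t, HasDerivAt F' (F'' t) t) (hc : ∀ t, F'' t ≤ c) :
    F 1 - 2 * F 0 + F (-1) ≤ c := by
  have d1 : ∀ t, HasDerivAt (fun t => c / 2 * t ^ 2 - F t) (c * t - F' t) t := fun t => by
    refine HasDerivAt.sub ?_ (h1 t)
    convert! (hasDerivAt_pow 2 t).const_mul (c / 2) using 1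
    ring
  have d2 : ∀ t, HasDerivAt (fun t => c * t - F' t) (c - F'' t) t := fun t => by
    refine HasDerivAt.sub ?_ (h2 t)
    simpa using (hasDerivAt_id t).const_mul c
  have e1 : deriv (fun t => c / 2 * t ^ 2 - F t) = fun t => c * t - F' t :=
    funext fun t => (d1 t).deriv
  have hconv : ConvexOn ℝ Set.univ (fun t => c / 2 * t ^ 2 - F t) := by
    refine convexOn_of_deriv2_nonneg' convex_univ
      (fun t _ => (d1 t).differentiableAt.differentiableWithinAt) ?_ fun t _ => ?_
    · rw [e1]
      exact fun t _ => (d2 t).differentiableAt.differentiableWithinAt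
    · rw [Function.iterate_succ, Function.iterate_one, Function.comp_apply, e1, (d2 t).deriv]
      linarith [hc t]
  have := hconv.2 (Set.mem_univ 1) (Set.mem_univ (-1)) (show (0 : ℝ) ≤ 1 / 2 by norm_num)
    (show (0 : ℝ) ≤ 1 / 2 by norm_num) (by norm_num)
  norm_num at this
  linarith

section SecondVariation

variable {N : ℕ}

/-- The pairings of `u` with the second-order divergences of admissible matrix fields. -/
def secondVariationSet (u : EuclideanSpace ℝ (Fin N) → ℝ) : Set ℝ :=
  {r : ℝ | ∃ φ : Fin N → Fin N → EuclideanSpace ℝ (Fin N) → ℝ,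
    (∀ i j, ContDiff ℝ (⊤ : ℕ∞) (φ i j) ∧ HasCompactSupport (φ i j)) ∧
    (∀ x, ∑ i, ∑ j, (φ i j x) ^ 2 ≤ 1) ∧
    r = ∫ x, u x * ∑ i, ∑ j, iteratedFDeriv ℝ 2 (φ i j) x
      ![EuclideanSpace.single i (1 : ℝ), EuclideanSpace.single j (1 : ℝ)]}

/-- Testing `D²u` against the rank-one field `ψ a ⊗ a` with `a` a unit vector. -/
theorem integral_mul_fderiv_fderiv_mem_secondVariationSet (u : EuclideanSpace ℝ (Fin N) → ℝ)
    {ψ : EuclideanSpace ℝ (Fin N) → ℝ} (hψ : ContDiff ℝ ∞ ψ) (hc : HasCompactSupport ψ)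
    (h1 : ∀ x, |ψ x| ≤ 1) {a : EuclideanSpace ℝ (Fin N)} (ha : ‖a‖ = 1) :
    ∫ x, u x * fderiv ℝ (fderiv ℝ ψ) x a a ∈ secondVariationSet u := by
  have hsum : ∑ i, a i ^ 2 = 1 := by
    rw [← EuclideanSpace.real_norm_sq_eq, ha, one_pow]
  refine ⟨fun i j x => (a i * a j) • ψ x, fun i j => ⟨contDiff_const.mul hψ,
    hc.mul_left (f := fun _ => a i * a j)⟩,
    fun x => ?_, ?_⟩
  · have : ∑ i, ∑ j, ((a i * a j) • ψ x) ^ 2 = (∑ i, a i ^ 2) * (∑ j, a j ^ 2) * ψ x ^ 2 := by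
      rw [Finset.sum_mul_sum, Finset.sum_mul]
      refine Finset.sum_congr rfl fun i _ => ?_
      rw [Finset.sum_mul]
      exact Finset.sum_congr rfl fun j _ => by rw [smul_eq_mul]; ring
    rw [this, hsum, one_mul, one_mul]
    exact (sq_le_one_iff_abs_le_one _).2 (h1 x)
  · congr 1 with x
    congr 1
    have hax : a = ∑ i, a i • EuclideanSpace.single i (1 : ℝ) := by
      simpa using ((EuclideanSpace.basisFun (Fin N) ℝ).sum_repr a).symm
    have hB : ∀ L : EuclideanSpace ℝ (Fin N) →L[ℝ] ℝ,
        L a = ∑ i, a i * L (EuclideanSpace.single i (1 : ℝ)) := fun L => by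
      conv_lhs => rw [hax]
      simp only [map_sum, map_smul, smul_eq_mul]
    have hxi : ∀ i j, iteratedFDeriv ℝ 2 (fun x => (a i * a j) • ψ x) x
        = (a i * a j) • iteratedFDeriv ℝ 2 ψ x := fun i j =>
      iteratedFDeriv_const_smul_apply' (contDiff_infty.1 hψ 2).contDiffAt
    have hflip := hB ((fderiv ℝ (fderiv ℝ ψ) x).flip a)
    simp only [ContinuousLinearMap.flip_apply] at hflip
    rw [hflip]
    refine Finset.sum_congr rfl fun i _ => ?_
    rw [hB, Finset.mul_sum]
    refine Finset.sum_congr rfl fun j _ => ?_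
    rw [hxi, smul_apply, iteratedFDeriv_two_apply, smul_eq_mul, mul_assoc]
    rfl

/-- For fixed `h`, the `L¹` norm of the second difference of `u` is at most `‖h‖² |D²u|`. -/
theorem integral_abs_second_difference_le {u : EuclideanSpace ℝ (Fin N) → ℝ}
    (hu : Integrable u) {V : ℝ} (hV : V ∈ upperBounds (secondVariationSet u))
    {h : EuclideanSpace ℝ (Fin N)} (hh : h ≠ 0) :
    ∫ x, |u (x + h) - 2 * u x + u (x - h)| ≤ ‖h‖ ^ 2 * V := by
  have hup := hu.comp_add_right h
  have hum := hu.comp_sub_right h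
  refine integral_abs_le_of_forall_contDiff ((hup.sub (hu.const_mul 2)).add hum)
    fun ψ hψ hc hψ1 => ?_
  set ψ' : EuclideanSpace ℝ (Fin N) → ℝ := fun x => fderiv ℝ ψ x h with hψ'
  have hψ's : ContDiff ℝ ∞ ψ' := (hψ.fderiv_right (by simp)).clm_apply contDiff_const
  have hF := second_difference_le_of_deriv2_le (c := ‖h‖ ^ 2 * V)
    (hasDerivAt_integral_mul_comp_add_smul hu (hψ.of_le (by simp)) hc h)
    (hasDerivAt_integral_mul_comp_add_smul hu (hψ's.of_le (by simp)) (hc.fderiv_apply ℝ h) h)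
    fun t => ?_
  · obtain ⟨D, hD⟩ := hc.exists_bound_of_continuous hψ.continuous
    have hi : ∀ {f : EuclideanSpace ℝ (Fin N) → ℝ} (b), Integrable f →
        Integrable fun x => f x * ψ (x + b) :=
      fun b hf => hf.mul_bdd (c := D) (hψ.continuous.comp
        (continuous_id.add continuous_const)).aestronglyMeasurable (.of_forall fun x => hD _)
    have i0 : ∀ {f : EuclideanSpace ℝ (Fin N) → ℝ}, Integrable f →
        Integrable fun x => f x * ψ x := fun hf => by simpa using hi 0 hf
    have e1 : ∫ x, u (x + h) * ψ x = ∫ x, u x * ψ (x + -h) := by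
      simpa using integral_add_right_eq_self (μ := volume) (fun x => u x * ψ (x + -h)) h
    have e2 : ∫ x, u (x - h) * ψ x = ∫ x, u x * ψ (x + h) := by
      simpa using integral_sub_right_eq_self (μ := volume) (fun x => u x * ψ (x + h)) h
    have e3 : ∫ x, (u (x + h) - 2 * u x + u (x - h)) * ψ x
        = (∫ x, u (x + h) * ψ x) - 2 * (∫ x, u x * ψ x) + ∫ x, u (x - h) * ψ x := by
      rw [← integral_const_mul, ← integral_sub (i0 hup) ((i0 hu).const_mul 2),
        ← integral_add (by exact (i0 hup).sub ((i0 hu).const_mul 2)) (i0 hum)]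
      congr 1 with x
      ring
    simp only [one_smul, zero_smul, add_zero, neg_smul] at hF
    refine le_trans (le_of_eq ?_) hF
    rw [← e1, ← e2]
    exact e3.trans (by ring)
  · have hn : ‖h‖ ≠ 0 := norm_ne_zero_iff.2 hh
    have ha : ‖(‖h‖⁻¹ • h)‖ = 1 := norm_smul_inv_norm hh
    have hmem := hV (integral_mul_fderiv_fderiv_mem_secondVariationSet u
      (ψ := fun x => ψ (x + t • h)) (hψ.comp (contDiff_id.add contDiff_const))
      (hc.comp_homeomorph (Homeomorph.addRight (t • h))) (fun x => hψ1 _) ha)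
    have hfd : fderiv ℝ (fun x => ψ (x + t • h)) = fun x => fderiv ℝ ψ (x + t • h) :=
      funext fun x => fderiv_comp_add_right _
    have hd : ∀ x, DifferentiableAt ℝ (fderiv ℝ ψ) x :=
      (hψ.fderiv_right (m := ∞) (by simp)).differentiable (by simp)
    have hψ'd : ∀ x, fderiv ℝ ψ' x h = fderiv ℝ (fderiv ℝ ψ) x h h := fun x => by
      rw [hψ', fderiv_clm_apply (hd x) (differentiableAt_const h)]
      simp
    have key : ∫ x, u x * fderiv ℝ ψ' (x + t • h) h = ‖h‖ ^ 2 *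
        ∫ x, u x * fderiv ℝ (fderiv ℝ fun x => ψ (x + t • h)) x (‖h‖⁻¹ • h) (‖h‖⁻¹ • h) := by
      rw [← integral_const_mul]
      congr 1 with x
      rw [hfd, fderiv_comp_add_right (f := fderiv ℝ ψ), hψ'd]
      simp only [map_smul, FunLike.coe_smul, Pi.smul_apply, smul_eq_mul]
      field_simp
    rw [key]
    exact mul_le_mul_of_nonneg_left hmem (sq_nonneg _)

end SecondVariation

/-- For `u ∈ BV²(ℝ^N)` (i.e. `u ∈ W^{1,1}` with weak gradient `g`, and finite second
variation `V = |D²u|(ℝ^N)`, encoded via its dual characterization as the supremum of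
`∫ u · div²φ` over smooth compactly supported matrix fields `φ` with pointwise norm ≤ 1)
and any nonnegative radially symmetric `ρ` with `∫ρ = 1`,
`∫∫ |u(x+h) - 2u(x) + u(x-h)| / |h|² ρ(h) dh dx ≤ M |D²u|(ℝ^N)` with `M = M(N)`. -/
theorem nonlocal_energy_BV2_bound (N : ℕ) :
    ∃ M : ℝ, 0 < M ∧
      ∀ (u : EuclideanSpace ℝ (Fin N) → ℝ)
        (g : EuclideanSpace ℝ (Fin N) → Fin N → ℝ) (V : ℝ)
        (ρ : EuclideanSpace ℝ (Fin N) → ℝ),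
        Integrable u →
        (∀ i, Integrable (fun x => g x i)) →
        (∀ φ : EuclideanSpace ℝ (Fin N) → ℝ, ContDiff ℝ (⊤ : ℕ∞) φ → HasCompactSupport φ →
          ∀ i, (∫ x, u x * fderiv ℝ φ x (EuclideanSpace.single i (1 : ℝ)))
            = -∫ x, g x i * φ x) →
        IsLUB {r : ℝ | ∃ φ : Fin N → Fin N → EuclideanSpace ℝ (Fin N) → ℝ,
            (∀ i j, ContDiff ℝ (⊤ : ℕ∞) (φ i j) ∧ HasCompactSupport (φ i j)) ∧
            (∀ x, ∑ i, ∑ j, (φ i j x) ^ 2 ≤ 1) ∧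
            r = ∫ x, u x * ∑ i, ∑ j, iteratedFDeriv ℝ 2 (φ i j) x
              ![EuclideanSpace.single i (1 : ℝ), EuclideanSpace.single j (1 : ℝ)]} V →
        (∀ z, 0 ≤ ρ z) → (∀ z z', ‖z‖ = ‖z'‖ → ρ z = ρ z') → Integrable ρ →
        (∫ z, ρ z) = 1 →
        (∫ x, ∫ h, |u (x + h) - 2 * u x + u (x - h)| / ‖h‖ ^ 2 * ρ h) ≤ M * V := by
  refine ⟨1, one_pos, fun u g V ρ hu _ _ hV hρ _ hρi hρ1 => ?_⟩
  replace hV : V ∈ upperBounds (secondVariationSet u) := hV.1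
  set f : EuclideanSpace ℝ (Fin N) → EuclideanSpace ℝ (Fin N) → ℝ :=
    fun x h => |u (x + h) - 2 * u x + u (x - h)| / ‖h‖ ^ 2 * ρ h with hf
  have hV0 : 0 ≤ V := hV ⟨fun _ _ _ => 0, fun i j => ⟨contDiff_const, .zero⟩,
    by simp, by simp⟩
  have hf0 : ∀ x h, 0 ≤ f x h := fun x h =>
    mul_nonneg (div_nonneg (abs_nonneg _) (sq_nonneg _)) (hρ h)
  have hmeas : AEStronglyMeasurable (Function.uncurry f) (volume.prod volume) := by
    have m1 := hu.aestronglyMeasurable.comp_quasiMeasurePreserving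
      (quasiMeasurePreserving_add (volume : Measure (EuclideanSpace ℝ (Fin N))) volume)
    have m2 := hu.aestronglyMeasurable.comp_quasiMeasurePreserving
      (quasiMeasurePreserving_sub_of_right_invariant
        (volume : Measure (EuclideanSpace ℝ (Fin N))) volume)
    have m3 := hu.aestronglyMeasurable.comp_fst (ν := (volume : Measure (EuclideanSpace ℝ (Fin N))))
    have m4 := hρi.aestronglyMeasurable.comp_snd
      (μ := (volume : Measure (EuclideanSpace ℝ (Fin N))))
    have m5 : AEStronglyMeasurable (fun p : EuclideanSpace ℝ (Fin N) × EuclideanSpace ℝ (Fin N) =>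
        (‖p.2‖ ^ 2)⁻¹) (volume.prod volume) :=
      Measurable.aestronglyMeasurable (by fun_prop)
    exact (((m1.sub (m3.const_mul 2)).add m2).norm.mul m5).mul m4
  have hint : ∀ h, Integrable fun x => f x h := fun h =>
    (((((hu.comp_add_right h).sub (hu.const_mul 2)).add (hu.comp_sub_right h)).abs).div_const
      _).mul_const _
  have hle : ∀ h, ∫ x, f x h ≤ V * ρ h := fun h => by
    rw [hf, integral_mul_const, integral_div]
    refine mul_le_mul_of_nonneg_right ?_ (hρ h)
    rcases eq_or_ne h 0 with rfl | hh
    · simpa using hV0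
    · rw [div_le_iff₀ (by positivity), mul_comm V]
      exact integral_abs_second_difference_le hu hV hh
  have hfi : Integrable (Function.uncurry f) (volume.prod volume) := by
    refine (integrable_prod_iff' hmeas).2 ⟨.of_forall hint, (hρi.const_mul V).mono'
      hmeas.norm.prod_swap.integral_prod_right' (.of_forall fun h => ?_)⟩
    simp only [Function.uncurry_apply_pair, Real.norm_of_nonneg (hf0 _ _)]
    rw [Real.norm_of_nonneg (integral_nonneg fun x => hf0 x h)]
    exact hle h
  rw [integral_integral_swap hfi]
  calc ∫ h, ∫ x, f x h ≤ ∫ h, V * ρ h :=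
        integral_mono hfi.integral_prod_right (hρi.const_mul V) hle
    _ = 1 * V := by rw [integral_const_mul, hρ1, mul_one, one_mul]
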